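/- Suppose ⟨δ_n : n < ω⟩ is an increasing sequence of ordinals with supremum δ, ⟨M_n : n < ω⟩ is a sequence of transitive ZFC models each of height δ, and ⟨j_{m,n} : M_m → M_n : m ≤ n < ω⟩ is a commuting system of elementary embeddings such that for all m ≤ n, crit(j_{n,n+1}) > j_{m,n}(δ_n). Then the direct limit of the system is well-founded and isomorphic to a transitive model M_ω of height δ with M_ω ⊆ ⋃_n M_n. -/

import Mathlib

open FirstOrder FirstOrder.Language

/-- The language of set theory: one binary relation symbol. -/
def ZFLang : FirstOrder.Language :=
  ⟨fun _ => Empty, fun n => match n with | 2 => Unit | _ => Empty⟩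

def memRel : ZFLang.Relations 2 := ()

/-- The membership structure on a class of ZF-sets. -/
noncomputable instance zfStr (M : Set ZFSet) : ZFLang.Structure ↥M where
  funMap {n} f _ := f.elim
  RelMap {n} r v :=
    match n, r, v with
    | 2, _, v => ((v 0 : ↥M) : ZFSet) ∈ ((v 1 : ↥M) : ZFSet)
    | 0, r, _ => r.elim
    | 1, r, _ => r.elim
    | (_+3), r, _ => r.elim

/-- The formula `x ∈ y`. -/
def mem' {n : ℕ} (x y : Fin n) : ZFLang.BoundedFormula Empty n :=
  Relations.boundedFormula₂ memRel (Term.var (Sum.inr x)) (Term.var (Sum.inr y))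

/-- The formula `x = y`. -/
def eq' {n : ℕ} (x y : Fin n) : ZFLang.BoundedFormula Empty n :=
  Term.bdEqual (Term.var (Sum.inr x)) (Term.var (Sum.inr y))

def extAx : ZFLang.Sentence :=
  ∀' ∀' ((∀' (mem' 2 0 ⇔ mem' 2 1)) ⟹ eq' 0 1)

def pairAx : ZFLang.Sentence :=
  ∀' ∀' ∃' ∀' (mem' 3 2 ⇔ (eq' 3 0 ⊔ eq' 3 1))

def unionAx : ZFLang.Sentence :=
  ∀' ∃' ∀' (mem' 2 1 ⇔ ∃' (mem' 3 0 ⊓ mem' 2 3))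

def powerAx : ZFLang.Sentence :=
  ∀' ∃' ∀' (mem' 2 1 ⇔ ∀' (mem' 3 2 ⟹ mem' 3 0))

def infAx : ZFLang.Sentence :=
  ∃' ((∃' (mem' 1 0 ⊓ ∀' (∼(mem' 2 1)))) ⊓
    (∀' (mem' 1 0 ⟹ ∃' (mem' 2 0 ⊓ ∀' (mem' 3 2 ⇔ (mem' 3 1 ⊔ eq' 3 1))))))

def foundAx : ZFLang.Sentence :=
  ∀' ((∃' (mem' 1 0)) ⟹ ∃' (mem' 1 0 ⊓ ∀' (mem' 2 1 ⟹ ∼(mem' 2 0))))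

/-- The separation axiom for a formula with `k` parameters. -/
def sepAx {k : ℕ} (φ : ZFLang.BoundedFormula Empty (k + 1)) : ZFLang.Sentence :=
  (mem' ⟨k+2, by omega⟩ ⟨k+1, by omega⟩ ⇔
      (mem' ⟨k+2, by omega⟩ ⟨k, by omega⟩ ⊓ φ.liftAt 2 k)).all.ex.all.alls

/-- The collection axiom for a formula with `k` parameters. -/
def collAx {k : ℕ} (φ : ZFLang.BoundedFormula Empty (k + 2)) : ZFLang.Sentence :=
  (mem' ⟨k+2, by omega⟩ ⟨k, by omega⟩ ⟹
      ((φ.liftAt 2 k).ex ⟹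
        ((mem' ⟨k+3, by omega⟩ ⟨k+1, by omega⟩ ⊓ φ.liftAt 2 k).ex))).all.ex.all.alls

def choiceAx : ZFLang.Sentence :=
  (((∀' ((mem' 1 0) ⟹ (∃' (mem' 2 1)))) ⊓
    (∀' ∀' ((((mem' 1 0) ⊓ (mem' 2 0)) ⊓ (∼(eq' 1 2))) ⟹ (∀' (∼((mem' 3 1) ⊓ (mem' 3 2)))))))
   ⟹
   (∃' ∀' ((mem' 2 0) ⟹
      (∃' (((mem' 3 2) ⊓ (mem' 3 1)) ⊓
        (∀' (((mem' 4 2) ⊓ (mem' 4 1)) ⟹ (eq' 4 3)))))))).all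

/-- The ZFC axioms: extensionality, pairing, union, powerset, infinity, foundation, choice,
separation, and collection. -/
def ZFCTheory : ZFLang.Theory :=
  {extAx, pairAx, unionAx, powerAx, infAx, foundAx, choiceAx} ∪
    (⋃ (k : ℕ), Set.range (@sepAx k)) ∪ (⋃ (k : ℕ), Set.range (@collAx k))

/-- A class of ZF-sets is transitive. -/
def SetTransitive (M : Set ZFSet) : Prop := ∀ x ∈ M, ∀ y : ZFSet, y ∈ x → y ∈ M

/-- A transitive model of ZFC. -/
def IsZFCModel (M : Set ZFSet) : Prop := SetTransitive M ∧ ZFCTheory.Model ↥M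

/-- Two classes have the same ordinals. -/
def SameOrdinals (M N : Set ZFSet) : Prop :=
  ∀ x : ZFSet, x.IsOrdinal → (x ∈ M ↔ x ∈ N)

/-- `z` is the pointwise image `j[x]` of `x` under `j`. -/
def ImageSet (M N : Set ZFSet) (j : ↥M → ↥N) (x z : ZFSet) : Prop :=
  ∀ w : ZFSet, w ∈ z ↔ ∃ y : ↥M, (y : ZFSet) ∈ x ∧ ((j y : ↥N) : ZFSet) = w

/-- `j : M → N` is amenable: every pointwise image `j[x]`, `x ∈ M`, belongs to `N`. -/
def Amenable (M N : Set ZFSet) (j : ↥M → ↥N) : Prop :=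
  ∀ x ∈ M, ∃ z ∈ N, ImageSet M N j x z

/-- `κ` is the critical point of `j`: the least ordinal moved. -/
def IsCrit (M N : Set ZFSet) (j : ↥M → ↥N) (κ : ZFSet) : Prop :=
  κ.IsOrdinal ∧ ∃ h : κ ∈ M, ((j ⟨κ, h⟩ : ↥N) : ZFSet) ≠ κ ∧
    ∀ β : ZFSet, β ∈ κ → ∀ hb : β ∈ M, ((j ⟨β, hb⟩ : ↥N) : ZFSet) = β

/-- `f` is a cofinal map from `β` into the ordinal `α`. -/
def CofinalIn (β α f : ZFSet) : Prop :=
  ∀ γ, γ ∈ α → ∃ ξ, ξ ∈ β ∧ ∃ η, ξ.pair η ∈ f ∧ (γ ∈ η ∨ γ = η)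

/-- `α` is a regular ordinal from the point of view of the class `M`. -/
def RegularIn (M : Set ZFSet) (α : ZFSet) : Prop :=
  ∀ β, β ∈ α → ∀ f, f ∈ M → ZFSet.IsFunc β α f → ¬ CofinalIn β α f

universe u

section Definability

theorem realize_mem' {M : Set ZFSet.{u}} {n : ℕ} {e : Empty → M} {v : Fin n → M} {i k : Fin n} :
    (mem' i k).Realize e v ↔ (v i : ZFSet) ∈ (v k : ZFSet) := by
  rw [mem', BoundedFormula.realize_rel₂]
  rfl

theorem realize_eq' {M : Set ZFSet.{u}} {n : ℕ} {e : Empty → M} {v : Fin n → M} {i k : Fin n} :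
    (eq' i k).Realize e v ↔ v i = v k := by
  rw [eq', BoundedFormula.realize_bdEqual]
  rfl

/-- A predicate that is defined by one parameter-free formula in all transitive models of ZFC. -/
def UniformlyDefinable {n : ℕ} (P : ∀ M : Set ZFSet.{u}, (Fin n → M) → Prop) : Prop :=
  ∃ φ : ZFLang.BoundedFormula Empty n, ∀ M, IsZFCModel M → ∀ (e : Empty → M) (v : Fin n → M),
    φ.Realize e v ↔ P M v

namespace UniformlyDefinable

variable {n : ℕ} {P Q : ∀ M : Set ZFSet.{u}, (Fin n → M) → Prop}

theorem mem (i k : Fin n) :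
    UniformlyDefinable fun (M : Set ZFSet.{u}) (v : Fin n → M) => (v i : ZFSet) ∈ (v k : ZFSet) :=
  ⟨mem' i k, fun _ _ _ _ => realize_mem'⟩

theorem eq (i k : Fin n) :
    UniformlyDefinable fun (M : Set ZFSet.{u}) (v : Fin n → M) => v i = v k :=
  ⟨eq' i k, fun _ _ _ _ => realize_eq'⟩

theorem not (hP : UniformlyDefinable P) : UniformlyDefinable fun M v => ¬ P M v := by
  obtain ⟨φ, hφ⟩ := hP
  exact ⟨∼φ, fun M hM e v => by rw [BoundedFormula.realize_not, hφ M hM]⟩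

theorem and (hP : UniformlyDefinable P) (hQ : UniformlyDefinable Q) :
    UniformlyDefinable fun M v => P M v ∧ Q M v := by
  obtain ⟨φ, hφ⟩ := hP
  obtain ⟨ψ, hψ⟩ := hQ
  exact ⟨φ ⊓ ψ, fun M hM e v => by rw [BoundedFormula.realize_inf, hφ M hM, hψ M hM]⟩

theorem or (hP : UniformlyDefinable P) (hQ : UniformlyDefinable Q) :
    UniformlyDefinable fun M v => P M v ∨ Q M v := by
  obtain ⟨φ, hφ⟩ := hP
  obtain ⟨ψ, hψ⟩ := hQ
  exact ⟨φ ⊔ ψ, fun M hM e v => by rw [BoundedFormula.realize_sup, hφ M hM, hψ M hM]⟩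

theorem imp (hP : UniformlyDefinable P) (hQ : UniformlyDefinable Q) :
    UniformlyDefinable fun M v => P M v → Q M v := by
  obtain ⟨φ, hφ⟩ := hP
  obtain ⟨ψ, hψ⟩ := hQ
  exact ⟨φ ⟹ ψ, fun M hM e v => by rw [BoundedFormula.realize_imp, hφ M hM, hψ M hM]⟩

theorem iff (hP : UniformlyDefinable P) (hQ : UniformlyDefinable Q) :
    UniformlyDefinable fun M v => P M v ↔ Q M v := by
  obtain ⟨φ, hφ⟩ := hP
  obtain ⟨ψ, hψ⟩ := hQ
  exact ⟨φ ⇔ ψ, fun M hM e v => by rw [BoundedFormula.realize_iff, hφ M hM, hψ M hM]⟩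

theorem all {R : ∀ M : Set ZFSet.{u}, (Fin n → M) → M → Prop}
    (hR : UniformlyDefinable fun M (v : Fin (n + 1) → M) =>
      R M (fun i => v i.castSucc) (v (Fin.last n))) :
    UniformlyDefinable fun M v => ∀ x, R M v x := by
  obtain ⟨φ, hφ⟩ := hR
  refine ⟨∀' φ, fun M hM e v => ?_⟩
  rw [BoundedFormula.realize_all]
  exact forall_congr' fun x => by simp [hφ M hM]

theorem ex {R : ∀ M : Set ZFSet.{u}, (Fin n → M) → M → Prop}
    (hR : UniformlyDefinable fun M (v : Fin (n + 1) → M) =>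
      R M (fun i => v i.castSucc) (v (Fin.last n))) :
    UniformlyDefinable fun M v => ∃ x, R M v x := by
  obtain ⟨φ, hφ⟩ := hR
  refine ⟨∃' φ, fun M hM e v => ?_⟩
  rw [BoundedFormula.realize_ex]
  exact exists_congr fun x => by simp [hφ M hM]

theorem congr (hP : UniformlyDefinable P) (h : ∀ M, IsZFCModel M → ∀ v, P M v ↔ Q M v) :
    UniformlyDefinable Q := by
  obtain ⟨φ, hφ⟩ := hP
  exact ⟨φ, fun M hM e v => (hφ M hM e v).trans (h M hM v)⟩

theorem elementary {M N : Set ZFSet.{u}} (hP : UniformlyDefinable P) (hM : IsZFCModel M)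
    (hN : IsZFCModel N) (j : M ↪ₑ[ZFLang] N) (v : Fin n → M) : P N (j ∘ v) ↔ P M v := by
  obtain ⟨φ, hφ⟩ := hP
  rw [← hφ N hN (j ∘ Empty.elim), ← hφ M hM Empty.elim, j.map_boundedFormula]

end UniformlyDefinable

end Definability

section Models

variable {M : Set ZFSet.{u}}

theorem IsZFCModel.realize (hM : IsZFCModel M) {φ : ZFLang.Sentence} (hφ : φ ∈ ZFCTheory) :
    M ⊨ φ :=
  hM.2.realize_of_mem φ hφ

theorem IsZFCModel.mem_of_mem (hM : IsZFCModel M) (x : M) {y : ZFSet.{u}} (h : y ∈ (x : ZFSet)) :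
    y ∈ M :=
  hM.1 x x.2 y h

theorem IsZFCModel.ext (hM : IsZFCModel M) {x y : M}
    (h : ∀ z : M, (z : ZFSet) ∈ (x : ZFSet) ↔ (z : ZFSet) ∈ (y : ZFSet)) : x = y := by
  refine Subtype.ext (ZFSet.ext fun z => ⟨fun hz => ?_, fun hz => ?_⟩)
  · exact (h ⟨z, hM.mem_of_mem x hz⟩).1 hz
  · exact (h ⟨z, hM.mem_of_mem y hz⟩).2 hz

theorem IsZFCModel.separation (hM : IsZFCModel M) {k : ℕ}
    {P : ∀ M : Set ZFSet.{u}, (Fin (k + 1) → M) → Prop} (hP : UniformlyDefinable P)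
    (p : Fin k → M) (a : M) :
    ∃ b : M, ∀ x : M, (x : ZFSet) ∈ (b : ZFSet) ↔
      (x : ZFSet) ∈ (a : ZFSet) ∧ P M (Fin.snoc p x) := by
  obtain ⟨φ, hφ⟩ := hP
  have h := hM.realize (φ := sepAx φ) (Or.inl (Or.inr (Set.mem_iUnion.2 ⟨k, φ, rfl⟩)))
  rw [sepAx, Sentence.Realize, BoundedFormula.realize_alls] at h
  have h := h p
  rw [BoundedFormula.realize_all] at h
  have h := h a
  rw [BoundedFormula.realize_ex] at h
  obtain ⟨b, hb⟩ := h
  refine ⟨b, fun x => ?_⟩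
  rw [BoundedFormula.realize_all] at hb
  have hb := hb x
  rw [BoundedFormula.realize_iff, BoundedFormula.realize_inf, realize_mem', realize_mem',
    BoundedFormula.realize_liftAt (by omega), hφ M hM] at hb
  have key : (Fin.snoc (Fin.snoc (Fin.snoc p a : Fin (k + 1) → M) b : Fin (k + 2) → M) x ∘
      fun i : Fin (k + 1) => if (i : ℕ) < k then Fin.castAdd 2 i else i.addNat 2) =
        (Fin.snoc p x : Fin (k + 1) → M) := by
    funext i
    refine Fin.lastCases ?_ (fun i => ?_) i
    · simp [Fin.snoc]
    · have h2 : (i : ℕ) < k + 2 := by omega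
      have h1 : (i : ℕ) < k + 1 := by omega
      simp [Fin.snoc, h1, h2]
      rfl
  rw [key] at hb
  simpa [Fin.snoc] using hb

theorem IsZFCModel.collection (hM : IsZFCModel M) {k : ℕ}
    {P : ∀ M : Set ZFSet.{u}, (Fin (k + 2) → M) → Prop} (hP : UniformlyDefinable P)
    (p : Fin k → M) (a : M) :
    ∃ b : M, ∀ x : M, (x : ZFSet) ∈ (a : ZFSet) →
      (∃ y, P M (Fin.snoc (Fin.snoc p x : Fin (k + 1) → M) y)) →
      ∃ y : M, (y : ZFSet) ∈ (b : ZFSet) ∧ P M (Fin.snoc (Fin.snoc p x : Fin (k + 1) → M) y) := by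
  obtain ⟨φ, hφ⟩ := hP
  have h := hM.realize (φ := collAx φ) (Or.inr (Set.mem_iUnion.2 ⟨k, φ, rfl⟩))
  rw [collAx, Sentence.Realize, BoundedFormula.realize_alls] at h
  have h := h p
  rw [BoundedFormula.realize_all] at h
  have h := h a
  rw [BoundedFormula.realize_ex] at h
  obtain ⟨b, hb⟩ := h
  refine ⟨b, fun x hx => ?_⟩
  rw [BoundedFormula.realize_all] at hb
  have key : ∀ y : M, (φ.liftAt 2 k).Realize (default : Empty → M)
      (Fin.snoc (Fin.snoc (Fin.snoc (Fin.snoc p a : Fin (k + 1) → M) b : Fin (k + 2) → M) x :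
        Fin (k + 3) → M) y) ↔ P M (Fin.snoc (Fin.snoc p x : Fin (k + 1) → M) y) := by
    intro y
    rw [BoundedFormula.realize_liftAt (by omega), hφ M hM]
    congr! 1
    funext i
    refine Fin.lastCases ?_ (fun i => Fin.lastCases ?_ (fun i => ?_) i) i
    · simp [Fin.snoc]
    · simp [Fin.snoc]
    · have h3 : (i : ℕ) < k + 3 := by omega
      have h2 : (i : ℕ) < k + 2 := by omega
      simp [Fin.snoc, h2, h3]
      rfl
  have hb := hb x
  simp only [BoundedFormula.realize_imp, BoundedFormula.realize_ex, BoundedFormula.realize_inf,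
    realize_mem', key] at hb
  simpa [Fin.snoc] using hb (by simpa [Fin.snoc] using hx)

theorem IsZFCModel.exists_pair (hM : IsZFCModel M) (x y : M) :
    ∃ z : M, ∀ w : M, (w : ZFSet) ∈ (z : ZFSet) ↔ w = x ∨ w = y := by
  have h := hM.realize (φ := pairAx) (by simp [ZFCTheory])
  simp only [pairAx, Sentence.Realize, Formula.Realize, BoundedFormula.realize_all,
    BoundedFormula.realize_ex, BoundedFormula.realize_iff, BoundedFormula.realize_sup,
    realize_mem', realize_eq'] at h
  exact h x y

theorem IsZFCModel.exists_sUnion (hM : IsZFCModel M) (x : M) :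
    ∃ z : M, ∀ w : M, (w : ZFSet) ∈ (z : ZFSet) ↔
      ∃ y : M, (y : ZFSet) ∈ (x : ZFSet) ∧ (w : ZFSet) ∈ (y : ZFSet) := by
  have h := hM.realize (φ := unionAx) (by simp [ZFCTheory])
  simp only [unionAx, Sentence.Realize, Formula.Realize, BoundedFormula.realize_all,
    BoundedFormula.realize_ex, BoundedFormula.realize_iff, BoundedFormula.realize_inf,
    realize_mem'] at h
  exact h x

theorem IsZFCModel.exists_powerset (hM : IsZFCModel M) (x : M) :
    ∃ z : M, ∀ w : M, (w : ZFSet) ∈ (z : ZFSet) ↔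
      ∀ y : M, (y : ZFSet) ∈ (w : ZFSet) → (y : ZFSet) ∈ (x : ZFSet) := by
  have h := hM.realize (φ := powerAx) (by simp [ZFCTheory])
  simp only [powerAx, Sentence.Realize, Formula.Realize, BoundedFormula.realize_all,
    BoundedFormula.realize_ex, BoundedFormula.realize_iff, BoundedFormula.realize_imp,
    realize_mem'] at h
  exact h x

theorem IsZFCModel.exists_transversal (hM : IsZFCModel M) (a : M)
    (hne : ∀ x : M, (x : ZFSet) ∈ (a : ZFSet) → ∃ y : M, (y : ZFSet) ∈ (x : ZFSet))
    (hdisj : ∀ x y : M, (x : ZFSet) ∈ (a : ZFSet) → (y : ZFSet) ∈ (a : ZFSet) →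
      (∃ z : M, (z : ZFSet) ∈ (x : ZFSet) ∧ (z : ZFSet) ∈ (y : ZFSet)) → x = y) :
    ∃ c : M, ∀ x : M, (x : ZFSet) ∈ (a : ZFSet) →
      ∃ z : M, ((z : ZFSet) ∈ (x : ZFSet) ∧ (z : ZFSet) ∈ (c : ZFSet)) ∧
        ∀ w : M, (w : ZFSet) ∈ (x : ZFSet) ∧ (w : ZFSet) ∈ (c : ZFSet) → w = z := by
  have h := hM.realize (φ := choiceAx) (by simp [ZFCTheory])
  simp only [choiceAx, Sentence.Realize, Formula.Realize, BoundedFormula.realize_all,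
    BoundedFormula.realize_ex, BoundedFormula.realize_imp, BoundedFormula.realize_inf,
    BoundedFormula.realize_not, realize_mem', realize_eq'] at h
  refine h a ⟨hne, fun x y hxy z hz => hxy.2 (hdisj x y hxy.1.1 hxy.1.2 ⟨z, hz⟩)⟩

theorem IsZFCModel.exists_insert (hM : IsZFCModel M) (x y : M) :
    ∃ z : M, ∀ w : M, (w : ZFSet) ∈ (z : ZFSet) ↔ (w : ZFSet) ∈ (x : ZFSet) ∨ w = y := by
  obtain ⟨s, hs⟩ := hM.exists_pair y y
  obtain ⟨p, hp⟩ := hM.exists_pair x s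
  obtain ⟨z, hz⟩ := hM.exists_sUnion p
  exact ⟨z, fun w => by simp [hz, hp, -Subtype.exists, or_and_right, exists_or, hs]⟩

theorem IsZFCModel.unordered_pair_mem (hM : IsZFCModel M) {x y : ZFSet.{u}} (hx : x ∈ M)
    (hy : y ∈ M) : ({x, y} : ZFSet) ∈ M := by
  obtain ⟨z, hz⟩ := hM.exists_pair ⟨x, hx⟩ ⟨y, hy⟩
  have : (z : ZFSet) = {x, y} := by
    ext w
    rw [ZFSet.mem_pair]
    refine ⟨fun hw => ?_, ?_⟩
    · simpa [Subtype.ext_iff] using (hz ⟨w, hM.mem_of_mem z hw⟩).1 hw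
    · rintro (rfl | rfl)
      · exact (hz ⟨_, hx⟩).2 (Or.inl rfl)
      · exact (hz ⟨_, hy⟩).2 (Or.inr rfl)
  exact this ▸ z.2

theorem IsZFCModel.pair_mem (hM : IsZFCModel M) (x y : M) : ZFSet.pair x y ∈ M := by
  have h := hM.unordered_pair_mem x.2 x.2
  rw [ZFSet.pair_eq_singleton] at h
  exact hM.unordered_pair_mem h (hM.unordered_pair_mem x.2 y.2)

theorem IsZFCModel.eq_unordered_pair_iff (hM : IsZFCModel M) (z x y : M) :
    (z : ZFSet) = {(x : ZFSet), (y : ZFSet)} ↔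
      ∀ w : M, (w : ZFSet) ∈ (z : ZFSet) ↔ w = x ∨ w = y := by
  refine ⟨fun h w => by simp [h, Subtype.ext_iff], fun h => ?_⟩
  have := hM.unordered_pair_mem x.2 y.2
  refine congrArg Subtype.val (hM.ext (x := z) (y := ⟨_, this⟩) fun w => ?_)
  simp [h, Subtype.ext_iff]

theorem IsZFCModel.isTransitive_iff (hM : IsZFCModel M) (x : M) :
    (x : ZFSet).IsTransitive ↔ ∀ y : M, (y : ZFSet) ∈ (x : ZFSet) →
      ∀ z : M, (z : ZFSet) ∈ (y : ZFSet) → (z : ZFSet) ∈ (x : ZFSet) := by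
  refine ⟨fun h y hy z hz => h.mem_trans hz hy, fun h y hy z hz => ?_⟩
  have hy' := hM.mem_of_mem x hy
  exact h ⟨y, hy'⟩ hy ⟨z, hM.mem_of_mem ⟨y, hy'⟩ hz⟩ hz

theorem IsZFCModel.isOrdinal_iff (hM : IsZFCModel M) (x : M) :
    (x : ZFSet).IsOrdinal ↔ (x : ZFSet).IsTransitive ∧
      ∀ y : M, (y : ZFSet) ∈ (x : ZFSet) → (y : ZFSet).IsTransitive := by
  rw [ZFSet.isOrdinal_iff_forall_mem_isTransitive]
  exact and_congr_right fun _ =>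
    ⟨fun h y hy => h y hy, fun h y hy => h ⟨y, hM.mem_of_mem x hy⟩ hy⟩

end Models

namespace UniformlyDefinable

variable {n : ℕ}

theorem unordered_pair (p x y : Fin n) :
    UniformlyDefinable fun (M : Set ZFSet.{u}) (v : Fin n → M) =>
      (v p : ZFSet) = {(v x : ZFSet), (v y : ZFSet)} := by
  refine congr (.all (.iff (.mem _ _) (.or (.eq _ _) (.eq _ _))))
    fun M hM v => (hM.eq_unordered_pair_iff (v p) (v x) (v y)).symm

theorem eq_pair (p x y : Fin n) :
    UniformlyDefinable fun (M : Set ZFSet.{u}) (v : Fin n → M) =>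
      (v p : ZFSet) = ZFSet.pair (v x) (v y) := by
  refine congr (P := fun M v => ∃ a b : M, (a : ZFSet) = {(v x : ZFSet), (v x : ZFSet)} ∧
    (b : ZFSet) = {(v x : ZFSet), (v y : ZFSet)} ∧
    (v p : ZFSet) = {(a : ZFSet), (b : ZFSet)}) ?_ fun M hM v => ?_
  · exact .ex (.ex (.and (unordered_pair _ _ _) (.and (unordered_pair _ _ _)
      (unordered_pair _ _ _))))
  · have hpair : ZFSet.pair (v x) (v y) =
        {{(v x : ZFSet), (v x : ZFSet)}, {(v x : ZFSet), (v y : ZFSet)}} := by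
      rw [ZFSet.pair_eq_singleton, ZFSet.pair]
    rw [hpair]
    constructor
    · rintro ⟨a, b, ha, hb, h⟩
      rw [h, ha, hb]
    · intro h
      exact ⟨⟨_, hM.unordered_pair_mem (v x).2 (v x).2⟩,
        ⟨_, hM.unordered_pair_mem (v x).2 (v y).2⟩, rfl, rfl, h⟩

theorem pair_mem (x y h : Fin n) :
    UniformlyDefinable fun (M : Set ZFSet.{u}) (v : Fin n → M) =>
      ZFSet.pair (v x) (v y) ∈ (v h : ZFSet) := by
  refine congr (P := fun M v => ∃ p : M, (p : ZFSet) = ZFSet.pair (v x) (v y) ∧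
    (p : ZFSet) ∈ (v h : ZFSet)) (.ex (.and (eq_pair _ _ _) (.mem _ _))) fun M hM v => ?_
  constructor
  · rintro ⟨p, hp, hm⟩
    rwa [hp] at hm
  · exact fun hm => ⟨⟨_, hM.pair_mem (v x) (v y)⟩, rfl, hm⟩

theorem isTransitive (x : Fin n) :
    UniformlyDefinable fun (M : Set ZFSet.{u}) (v : Fin n → M) =>
      (v x : ZFSet).IsTransitive :=
  congr (.all (.imp (.mem _ _) (.all (.imp (.mem _ _) (.mem _ _)))))
    fun _ hM v => (hM.isTransitive_iff (v x)).symm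

theorem isOrdinal (x : Fin n) :
    UniformlyDefinable fun (M : Set ZFSet.{u}) (v : Fin n → M) =>
      (v x : ZFSet).IsOrdinal :=
  congr (.and (isTransitive _) (.all (.imp (.mem _ _) (isTransitive _))))
    fun _ hM v => (hM.isOrdinal_iff (v x)).symm

end UniformlyDefinable

section TransitiveContainer

variable {M : Set ZFSet.{u}}

theorem IsZFCModel.exists_isTransitive_mem (hM : IsZFCModel M) (x : M) :
    ∃ t : M, (t : ZFSet).IsTransitive ∧ (x : ZFSet) ∈ (t : ZFSet) := by
  obtain ⟨x, hx⟩ := x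
  induction x using ZFSet.inductionOn with
  | _ x ih =>
  obtain ⟨b, hb⟩ := hM.collection (k := 0)
    (P := fun M v => (v 1 : ZFSet).IsTransitive ∧ (v 0 : ZFSet) ∈ (v 1 : ZFSet))
    (.and (.isTransitive _) (.mem _ _)) Fin.elim0 ⟨x, hx⟩
  obtain ⟨b', hb'⟩ := hM.separation (k := 0) (P := fun M v => (v 0 : ZFSet).IsTransitive)
    (.isTransitive _) Fin.elim0 b
  obtain ⟨s, hs⟩ := hM.exists_sUnion b'
  obtain ⟨t, ht⟩ := hM.exists_insert s ⟨x, hx⟩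
  have hxs : ∀ y : M, (y : ZFSet) ∈ x → (y : ZFSet) ∈ (s : ZFSet) := by
    intro y hy
    obtain ⟨r, hrb, hrt, hyr⟩ := hb y hy (ih y hy y.2)
    exact (hs y).2 ⟨r, (hb' r).2 ⟨hrb, hrt⟩, hyr⟩
  refine ⟨t, (hM.isTransitive_iff t).2 fun y hy z hz => ?_, (ht _).2 (Or.inr rfl)⟩
  rw [ht] at hy ⊢
  rcases hy with hy | rfl
  · obtain ⟨r, hr, hyr⟩ := (hs y).1 hy
    exact Or.inl ((hs z).2 ⟨r, hr, ((hb' r).1 hr).2.mem_trans hz hyr⟩)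
  · exact Or.inl (hxs z hz)

end TransitiveContainer

section Enumeration

/-- The part of `t` that remains before stage `ξ` when the element selected by `c` is removed
at each stage. -/
noncomputable def leftover (t c ξ : ZFSet.{u}) : ZFSet.{u} :=
  t.sep fun u => ∀ η : {η // η ∈ ξ},
    ¬ (u ∈ leftover t c η.1 ∧ ZFSet.pair (leftover t c η.1) u ∈ c)
termination_by ξ
decreasing_by exact η.2

theorem mem_leftover {t c ξ u : ZFSet.{u}} :
    u ∈ leftover t c ξ ↔ u ∈ t ∧ ∀ η, η ∈ ξ →
      ¬ (u ∈ leftover t c η ∧ ZFSet.pair (leftover t c η) u ∈ c) := by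
  rw [leftover, ZFSet.mem_sep, Subtype.forall]

/-- `h` is a set of pairs `(ξ, leftover t c ξ)` whose domain is transitive, as expressed in `M`. -/
def IsThinning (M : Set ZFSet.{u}) (t c h : M) : Prop :=
  ∀ ξ B : M, ZFSet.pair ξ B ∈ (h : ZFSet) →
    (∀ η : M, (η : ZFSet) ∈ (ξ : ZFSet) → ∃ C : M, ZFSet.pair η C ∈ (h : ZFSet)) ∧
    ∀ u : M, (u : ZFSet) ∈ (B : ZFSet) ↔ (u : ZFSet) ∈ (t : ZFSet) ∧
      ∀ η : M, (η : ZFSet) ∈ (ξ : ZFSet) → ∀ C : M, ZFSet.pair η C ∈ (h : ZFSet) →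
        ¬ ((u : ZFSet) ∈ (C : ZFSet) ∧ ZFSet.pair C u ∈ (c : ZFSet))

/-- `u` is the element of `t` selected by `c` at stage `ξ`, as expressed in `M`. -/
def IsSelectedAt (M : Set ZFSet.{u}) (t c ξ u : M) : Prop :=
  ∃ h B : M, IsThinning M t c h ∧ ZFSet.pair ξ B ∈ (h : ZFSet) ∧
    (u : ZFSet) ∈ (B : ZFSet) ∧ ZFSet.pair B u ∈ (c : ZFSet)

theorem UniformlyDefinable.isThinning {n : ℕ} (t c h : Fin n) :
    UniformlyDefinable fun (M : Set ZFSet.{u}) (v : Fin n → M) =>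
      IsThinning M (v t) (v c) (v h) :=
  .all (.all (.imp (.pair_mem _ _ _) (.and (.all (.imp (.mem _ _) (.ex (.pair_mem _ _ _))))
    (.all (.iff (.mem _ _) (.and (.mem _ _) (.all (.imp (.mem _ _) (.all (.imp (.pair_mem _ _ _)
      (.not (.and (.mem _ _) (.pair_mem _ _ _)))))))))))))

theorem UniformlyDefinable.isSelectedAt {n : ℕ} (t c ξ u : Fin n) :
    UniformlyDefinable fun (M : Set ZFSet.{u}) (v : Fin n → M) =>
      IsSelectedAt M (v t) (v c) (v ξ) (v u) :=
  .ex (.ex (.and (.isThinning _ _ _) (.and (.pair_mem _ _ _)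
    (.and (.mem _ _) (.pair_mem _ _ _)))))

variable {M : Set ZFSet.{u}}

theorem IsThinning.eq_leftover (hM : IsZFCModel M) {t c h : M} (hh : IsThinning M t c h)
    (ξ B : M) (hB : ZFSet.pair ξ B ∈ (h : ZFSet)) : (B : ZFSet) = leftover t c ξ := by
  obtain ⟨ξ, hξ⟩ := ξ
  induction ξ using ZFSet.inductionOn generalizing B with
  | _ ξ ih =>
  obtain ⟨hdom, hmem⟩ := hh ⟨ξ, hξ⟩ B hB
  ext u
  rw [mem_leftover]
  constructor
  · intro hu
    obtain ⟨hut, h2⟩ := (hmem ⟨u, hM.mem_of_mem B hu⟩).1 hu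
    refine ⟨hut, fun η hη => ?_⟩
    have hηM := hM.mem_of_mem ⟨ξ, hξ⟩ hη
    obtain ⟨C, hC⟩ := hdom ⟨η, hηM⟩ hη
    have := h2 ⟨η, hηM⟩ hη C hC
    rwa [ih η hη C hηM hC] at this
  · rintro ⟨hut, h2⟩
    refine (hmem ⟨u, hM.mem_of_mem t hut⟩).2 ⟨hut, fun η hη C hC => ?_⟩
    have := h2 η hη
    rwa [← ih η hη C η.2 hC] at this

theorem isThinning_iff (hM : IsZFCModel M) {t c h : M} : IsThinning M t c h ↔
    ∀ ξ B : M, ZFSet.pair ξ B ∈ (h : ZFSet) → (B : ZFSet) = leftover t c ξ ∧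
      ∀ η, η ∈ (ξ : ZFSet) → ZFSet.pair η (leftover t c η) ∈ (h : ZFSet) := by
  constructor
  · refine fun hh ξ B hB => ⟨hh.eq_leftover hM ξ B hB, fun η hη => ?_⟩
    obtain ⟨C, hC⟩ := (hh ξ B hB).1 ⟨η, hM.mem_of_mem ξ hη⟩ hη
    rwa [← hh.eq_leftover hM ⟨η, hM.mem_of_mem ξ hη⟩ C hC]
  · intro H ξ B hB
    obtain ⟨h1, h2⟩ := H ξ B hB
    have hC : ∀ η : M, (η : ZFSet) ∈ (ξ : ZFSet) → ∃ C : M,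
        (C : ZFSet) = leftover t c η ∧ ZFSet.pair η C ∈ (h : ZFSet) := by
      intro η hη
      have hp := h2 η hη
      have hL : leftover t c η ∈ M := by
        have hq := hM.mem_of_mem h hp
        refine hM.mem_of_mem ⟨_, hM.mem_of_mem ⟨_, hq⟩
          (y := {(η : ZFSet), leftover t c η}) ?_⟩ ?_ <;> simp [ZFSet.pair]
      exact ⟨⟨_, hL⟩, rfl, hp⟩
    refine ⟨fun η hη => (hC η hη).imp fun C hC => hC.2, fun u => ?_⟩
    rw [h1, mem_leftover]
    refine and_congr_right fun _ => ⟨fun H2 η hη C hC => ?_, fun H2 η hη => ?_⟩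
    · rw [(H η C hC).1]
      exact H2 η hη
    · obtain ⟨C, hCe, hCm⟩ := hC ⟨η, hM.mem_of_mem ξ hη⟩ hη
      have := H2 ⟨η, hM.mem_of_mem ξ hη⟩ hη C hCm
      rwa [hCe] at this

theorem exists_isThinning (hM : IsZFCModel M) (t c ξ : M) :
    ∃ h : M, IsThinning M t c h ∧ ∃ B : M, ZFSet.pair ξ B ∈ (h : ZFSet) := by
  obtain ⟨ξ, hξ⟩ := ξ
  induction ξ using ZFSet.inductionOn with
  | _ ξ ih =>
  obtain ⟨b, hb⟩ := hM.collection (k := 2)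
    (P := fun M v => IsThinning M (v 0) (v 1) (v 3) ∧
      ∃ B : M, ZFSet.pair (v 2) B ∈ (v 3 : ZFSet))
    (.and (.isThinning _ _ _) (.ex (.pair_mem _ _ _))) ![t, c] ⟨ξ, hξ⟩
  obtain ⟨b', hb'⟩ := hM.separation (k := 2) (P := fun M v => IsThinning M (v 0) (v 1) (v 2))
    (.isThinning _ _ _) ![t, c] b
  obtain ⟨H, hH⟩ := hM.exists_sUnion b'
  have hHdom : ∀ η, η ∈ ξ → ∃ C : M, (C : ZFSet) = leftover t c η ∧
      ZFSet.pair η C ∈ (H : ZFSet) := by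
    intro η hη
    have hηM := hM.mem_of_mem ⟨ξ, hξ⟩ hη
    obtain ⟨r, hrb, hr, B, hB⟩ := hb ⟨η, hηM⟩ hη (ih η hη hηM)
    have hr' : IsThinning M t c r := hr
    have hB' : ZFSet.pair η B ∈ (r : ZFSet) := hB
    have := hr'.eq_leftover hM ⟨η, hηM⟩ B hB'
    exact ⟨B, this, (hH ⟨_, hM.mem_of_mem r hB'⟩).2 ⟨r, (hb' r).2 ⟨hrb, hr⟩, hB'⟩⟩
  have hHthin : IsThinning M t c H := by
    refine (isThinning_iff hM).2 fun ζ B hB => ?_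
    obtain ⟨r, hr, hBr⟩ := (hH ⟨_, hM.mem_of_mem H hB⟩).1 hB
    have hr' : IsThinning M t c r := ((hb' r).1 hr).2
    obtain ⟨h1, h2⟩ := (isThinning_iff hM).1 hr' ζ B hBr
    exact ⟨h1, fun η hη => (hH ⟨_, hM.mem_of_mem r (h2 η hη)⟩).2 ⟨r, hr, h2 η hη⟩⟩
  obtain ⟨L, hL⟩ := hM.separation (k := 3)
    (P := fun M v => ∀ η : M, (η : ZFSet) ∈ (v 2 : ZFSet) → ∀ C : M,
      ZFSet.pair η C ∈ (v 0 : ZFSet) →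
        ¬ ((v 3 : ZFSet) ∈ (C : ZFSet) ∧ ZFSet.pair C (v 3) ∈ (v 1 : ZFSet)))
    (.all (.imp (.mem _ _) (.all (.imp (.pair_mem _ _ _)
      (.not (.and (.mem _ _) (.pair_mem _ _ _))))))) ![H, c, ⟨ξ, hξ⟩] t
  obtain ⟨h, hh⟩ := hM.exists_insert H ⟨_, hM.pair_mem ⟨ξ, hξ⟩ L⟩
  have hLe : (L : ZFSet) = leftover t c ξ := by
    ext u
    rw [mem_leftover]
    constructor
    · intro hu
      obtain ⟨hut, h2⟩ := (hL ⟨u, hM.mem_of_mem L hu⟩).1 hu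
      refine ⟨hut, fun η hη => ?_⟩
      have hηM := hM.mem_of_mem ⟨ξ, hξ⟩ hη
      obtain ⟨C, hCe, hC⟩ := hHdom η hη
      exact hCe ▸ h2 ⟨η, hηM⟩ hη C hC
    · rintro ⟨hut, h2⟩
      refine (hL ⟨u, hM.mem_of_mem t hut⟩).2 ⟨hut, fun η hη C hC => ?_⟩
      have := h2 η hη
      rwa [← hHthin.eq_leftover hM η C hC] at this
  have hsub : ∀ p, p ∈ (H : ZFSet) → p ∈ (h : ZFSet) := fun p hp =>
    (hh ⟨p, hM.mem_of_mem H hp⟩).2 (Or.inl hp)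
  refine ⟨h, (isThinning_iff hM).2 fun ζ B hB => ?_, L, (hh _).2 (Or.inr rfl)⟩
  rcases (hh ⟨_, hM.mem_of_mem h hB⟩).1 hB with hB | hB
  · obtain ⟨h1, h2⟩ := (isThinning_iff hM).1 hHthin ζ B hB
    exact ⟨h1, fun η hη => hsub _ (h2 η hη)⟩
  · obtain ⟨h1, h2⟩ := ZFSet.pair_inj.1 (congrArg Subtype.val hB)
    simp only at h1
    rw [h1, h2]
    refine ⟨hLe, fun η hη => hsub _ ?_⟩
    obtain ⟨C, hCe, hC⟩ := hHdom η hη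
    rwa [← hCe]

theorem exists_leftover (hM : IsZFCModel M) (t c ξ : M) :
    ∃ B : M, (B : ZFSet) = leftover t c ξ := by
  obtain ⟨h, hh, B, hB⟩ := exists_isThinning hM t c ξ
  exact ⟨B, hh.eq_leftover hM ξ B hB⟩

theorem isSelectedAt_iff (hM : IsZFCModel M) {t c ξ u : M} : IsSelectedAt M t c ξ u ↔
    (u : ZFSet) ∈ leftover t c ξ ∧ ZFSet.pair (leftover t c ξ) u ∈ (c : ZFSet) := by
  constructor
  · rintro ⟨h, B, hh, hB, hu, hc⟩
    rw [← hh.eq_leftover hM ξ B hB]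
    exact ⟨hu, hc⟩
  · intro H
    obtain ⟨h, hh, B, hB⟩ := exists_isThinning hM t c ξ
    rw [← hh.eq_leftover hM ξ B hB] at H
    exact ⟨h, B, hh, hB, H⟩

/-- `c` contains a choice function on the nonempty subsets of `t`, as expressed in `M`. -/
def IsSelector (M : Set ZFSet.{u}) (t c : M) : Prop :=
  ∀ A : M, (A : ZFSet) ⊆ t → (∃ u : M, (u : ZFSet) ∈ (A : ZFSet)) →
    ∃ u : M, ((u : ZFSet) ∈ (A : ZFSet) ∧ ZFSet.pair A u ∈ (c : ZFSet)) ∧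
      ∀ w : M, (w : ZFSet) ∈ (A : ZFSet) ∧ ZFSet.pair A w ∈ (c : ZFSet) → w = u

theorem exists_isSelector (hM : IsZFCModel M) (t : M) : ∃ c : M, IsSelector M t c := by
  have hprod : ∀ A : M, ∃ q : M, ∀ p : M, (p : ZFSet) ∈ (q : ZFSet) ↔
      ∃ u : M, (u : ZFSet) ∈ (A : ZFSet) ∧ (p : ZFSet) = ZFSet.pair A u := by
    intro A
    obtain ⟨b, hb⟩ := hM.collection (k := 1)
      (P := fun M v => (v 2 : ZFSet) = ZFSet.pair (v 0) (v 1)) (.eq_pair _ _ _) ![A] A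
    obtain ⟨q, hq⟩ := hM.separation (k := 1)
      (P := fun M v => ∃ u : M, (u : ZFSet) ∈ (v 0 : ZFSet) ∧ (v 1 : ZFSet) = ZFSet.pair (v 0) u)
      (.ex (.and (.mem _ _) (.eq_pair _ _ _))) ![A] b
    refine ⟨q, fun p => (hq p).trans ⟨fun h => h.2, fun h => ⟨?_, h⟩⟩⟩
    obtain ⟨u, hu, hp⟩ := h
    obtain ⟨p', hp'b, hp'⟩ := hb u hu ⟨p, hp⟩
    rwa [show p = p' from Subtype.ext (hp.trans hp'.symm)]
  obtain ⟨P, hP⟩ := hM.exists_powerset t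
  obtain ⟨b, hb⟩ := hM.collection (k := 0)
    (P := fun M v => ∀ p : M, (p : ZFSet) ∈ (v 1 : ZFSet) ↔
      ∃ u : M, (u : ZFSet) ∈ (v 0 : ZFSet) ∧ (p : ZFSet) = ZFSet.pair (v 0) u)
    (.all (.iff (.mem _ _) (.ex (.and (.mem _ _) (.eq_pair _ _ _))))) Fin.elim0 P
  obtain ⟨a, ha⟩ := hM.separation (k := 0)
    (P := fun M v => ∃ A : M, (∃ u : M, (u : ZFSet) ∈ (A : ZFSet)) ∧
      ∀ p : M, (p : ZFSet) ∈ (v 0 : ZFSet) ↔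
        ∃ u : M, (u : ZFSet) ∈ (A : ZFSet) ∧ (p : ZFSet) = ZFSet.pair A u)
    (.ex (.and (.ex (.mem _ _)) (.all (.iff (.mem _ _)
      (.ex (.and (.mem _ _) (.eq_pair _ _ _))))))) Fin.elim0 b
  obtain ⟨c, hc⟩ := hM.exists_transversal a
    (by
      intro q hq
      obtain ⟨_, A, ⟨u, hu⟩, hA⟩ := (ha q).1 hq
      exact ⟨⟨_, hM.pair_mem A u⟩, (hA _).2 ⟨u, hu, rfl⟩⟩)
    (by
      rintro q q' hq hq' ⟨z, hz, hz'⟩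
      obtain ⟨_, A, -, hA⟩ := (ha q).1 hq
      obtain ⟨_, A', -, hA'⟩ := (ha q').1 hq'
      obtain ⟨u, hu, hzu⟩ := (hA z).1 hz
      obtain ⟨u', hu', hzu'⟩ := (hA' z).1 hz'
      obtain rfl : A = A' := Subtype.ext (ZFSet.pair_inj.1 (hzu.symm.trans hzu')).1
      exact hM.ext fun w => (hA w).trans (hA' w).symm)
  refine ⟨c, fun A hAt hne => ?_⟩
  obtain ⟨q, hqb, hq⟩ := hb A ((hP A).2 fun y hy => hAt hy) (hprod A)
  have hq : ∀ p : M, (p : ZFSet) ∈ (q : ZFSet) ↔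
      ∃ u : M, (u : ZFSet) ∈ (A : ZFSet) ∧ (p : ZFSet) = ZFSet.pair A u := hq
  obtain ⟨z, ⟨hzq, hzc⟩, hz⟩ := hc q ((ha q).2 ⟨hqb, A, hne, hq⟩)
  obtain ⟨u, hu, hzu⟩ := (hq z).1 hzq
  refine ⟨u, ⟨hu, hzu ▸ hzc⟩, fun w hw => ?_⟩
  have := hz ⟨_, hM.pair_mem A w⟩ ⟨(hq _).2 ⟨w, hw.1, rfl⟩, hw.2⟩
  exact Subtype.ext (ZFSet.pair_inj.1 ((congrArg Subtype.val this).trans hzu)).2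

theorem IsSelector.isSelectedAt_unique (hM : IsZFCModel M) {t c : M} (hc : IsSelector M t c)
    {ξ u w : M} (hu : IsSelectedAt M t c ξ u) (hw : IsSelectedAt M t c ξ w) : u = w := by
  obtain ⟨B, hB⟩ := exists_leftover hM t c ξ
  rw [isSelectedAt_iff hM, ← hB] at hu hw
  obtain ⟨z, -, hz⟩ := hc B (fun x hx => by
    rw [hB, mem_leftover] at hx
    exact hx.1) ⟨u, hu.1⟩
  rw [hz u hu, hz w hw]

theorem IsZFCModel.not_forall_isOrdinal_mem (hM : IsZFCModel M) (b : M) :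
    ∃ ξ : M, (ξ : ZFSet).IsOrdinal ∧ (ξ : ZFSet) ∉ (b : ZFSet) := by
  by_contra! H
  obtain ⟨o, ho⟩ := hM.separation (k := 0) (P := fun M v => (v 0 : ZFSet).IsOrdinal)
    (.isOrdinal _) Fin.elim0 b
  have ho : ∀ x : M, (x : ZFSet) ∈ (o : ZFSet) ↔ (x : ZFSet).IsOrdinal := fun x =>
    (ho x).trans ⟨fun h => h.2, fun h => ⟨H x h, h⟩⟩
  refine ZFSet.mem_irrefl _ ((ho o).2 ((hM.isOrdinal_iff o).2
    ⟨(hM.isTransitive_iff o).2 fun y hy z hz => ?_, fun y hy => ?_⟩))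
  · exact (ho z).2 (((ho y).1 hy).mem hz)
  · exact ((ho y).1 hy).isTransitive

theorem IsSelector.exists_isOrdinal (hM : IsZFCModel M) {t c : M} (hc : IsSelector M t c) :
    ∃ l : M, (l : ZFSet).IsOrdinal ∧ ∀ u : M, (u : ZFSet) ∈ (t : ZFSet) →
      ∃ ξ : M, (ξ : ZFSet) ∈ (l : ZFSet) ∧ IsSelectedAt M t c ξ u := by
  obtain ⟨b, hb⟩ := hM.collection (k := 2)
    (P := fun M v => (v 3 : ZFSet).IsOrdinal ∧ IsSelectedAt M (v 0) (v 1) (v 3) (v 2))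
    (.and (.isOrdinal _) (.isSelectedAt _ _ _ _)) ![t, c] t
  obtain ⟨l, hl, hlb⟩ := hM.not_forall_isOrdinal_mem b
  have hempty : ∀ u : M, (u : ZFSet) ∉ leftover t c l := by
    intro u hu
    obtain ⟨B, hB⟩ := exists_leftover hM t c l
    obtain ⟨w, hw, -⟩ := hc B (fun x hx => by
      rw [hB, mem_leftover] at hx
      exact hx.1) ⟨u, hB ▸ hu⟩
    rw [hB] at hw
    have hwt : (w : ZFSet) ∈ (t : ZFSet) := (mem_leftover.1 hw.1).1
    obtain ⟨ξ, hξb, hξ, hξw⟩ := hb w hwt ⟨l, hl, (isSelectedAt_iff hM).2 hw⟩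
    have hξ : (ξ : ZFSet).IsOrdinal := hξ
    have hξw : IsSelectedAt M t c ξ w := hξw
    rw [isSelectedAt_iff hM] at hξw
    rcases hl.mem_trichotomous hξ with h | h | h
    · exact (mem_leftover.1 hξw.1).2 l h hw
    · exact hlb (h ▸ hξb)
    · exact (mem_leftover.1 hw.1).2 ξ h hξw
  refine ⟨l, hl, fun u hu => ?_⟩
  have := hempty u
  rw [mem_leftover] at this
  push Not at this
  obtain ⟨ξ, hξ, h⟩ := this hu
  exact ⟨⟨ξ, hM.mem_of_mem l hξ⟩, hξ, (isSelectedAt_iff hM).2 h⟩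

end Enumeration

section Embeddings

variable {M N : Set ZFSet.{u}}

/-- The set `t` is transitive, and the selection process for `c` is a functional enumeration
of `t` in at most `l` steps. -/
def IsEnumerated (M : Set ZFSet.{u}) (t c l : M) : Prop :=
  (t : ZFSet).IsTransitive ∧
    (∀ u : M, (u : ZFSet) ∈ (t : ZFSet) →
      ∃ ξ : M, (ξ : ZFSet) ∈ (l : ZFSet) ∧ IsSelectedAt M t c ξ u) ∧
    ∀ ξ u w : M, IsSelectedAt M t c ξ u → IsSelectedAt M t c ξ w → u = w

theorem exists_isEnumerated (hM : IsZFCModel M) (x : M) :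
    ∃ t c l : M, (l : ZFSet).IsOrdinal ∧ (x : ZFSet) ∈ (t : ZFSet) ∧ IsEnumerated M t c l := by
  obtain ⟨t, ht, hx⟩ := hM.exists_isTransitive_mem x
  obtain ⟨c, hc⟩ := exists_isSelector hM t
  obtain ⟨l, hl, hs⟩ := hc.exists_isOrdinal hM
  exact ⟨t, c, l, hl, hx, ht, hs, fun _ _ _ => hc.isSelectedAt_unique hM⟩

variable (j : M ↪ₑ[ZFLang] N)

theorem map_mem_iff (x y : M) : (j x : ZFSet) ∈ (j y : ZFSet) ↔ (x : ZFSet) ∈ (y : ZFSet) := by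
  have := j.map_boundedFormula (mem' (0 : Fin 2) 1) Empty.elim ![x, y]
  rwa [realize_mem', realize_mem'] at this

theorem map_isOrdinal_iff (hM : IsZFCModel M) (hN : IsZFCModel N) (x : M) :
    (j x : ZFSet).IsOrdinal ↔ (x : ZFSet).IsOrdinal :=
  (UniformlyDefinable.isOrdinal (0 : Fin 1)).elementary hM hN j ![x]

theorem IsEnumerated.map (hM : IsZFCModel M) (hN : IsZFCModel N) {t c l : M}
    (h : IsEnumerated M t c l) : IsEnumerated N (j t) (j c) (j l) := by
  have hdef : UniformlyDefinable fun (M : Set ZFSet.{u}) (v : Fin 3 → M) =>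
      IsEnumerated M (v 0) (v 1) (v 2) :=
    .and (.isTransitive _) (.and
      (.all (.imp (.mem _ _) (.ex (.and (.mem _ _) (.isSelectedAt _ _ _ _)))))
      (.all (.all (.all (.imp (.isSelectedAt _ _ _ _)
        (.imp (.isSelectedAt _ _ _ _) (.eq _ _)))))))
  exact (hdef.elementary hM hN j ![t, c, l]).2 h

theorem IsEnumerated.map_eq (hM : IsZFCModel M) (hN : IsZFCModel N) {t c l : M}
    (h : IsEnumerated M t c l) (hl : (j l : ZFSet) = l)
    (hfix : ∀ ξ : M, (ξ : ZFSet) ∈ (l : ZFSet) → (j ξ : ZFSet) = ξ) (y : M)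
    (hy : (y : ZFSet) ∈ (t : ZFSet)) : (j y : ZFSet) = y := by
  obtain ⟨y, hyM⟩ := y
  induction y using ZFSet.inductionOn with
  | _ y ih =>
  have ih : ∀ u : M, (u : ZFSet) ∈ y → (j u : ZFSet) = u := fun u hu =>
    ih u hu u.2 (h.1.mem_trans hu hy)
  obtain ⟨hjt, hjs, hju⟩ := h.map j hM hN
  ext z
  constructor
  · intro hz
    have hzt := hjt.mem_trans hz ((map_mem_iff j _ _).2 hy)
    obtain ⟨η, hη, hs⟩ := hjs ⟨z, hN.mem_of_mem _ hz⟩ hzt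
    rw [hl] at hη
    obtain ⟨ξ, rfl⟩ : ∃ ξ : M, j ξ = η :=
      ⟨⟨η, hM.mem_of_mem l hη⟩, Subtype.ext (hfix ⟨η, hM.mem_of_mem l hη⟩ hη)⟩
    have hex : UniformlyDefinable fun (M : Set ZFSet.{u}) (v : Fin 3 → M) =>
        ∃ u, IsSelectedAt M (v 0) (v 1) (v 2) u := .ex (.isSelectedAt _ _ _ _)
    obtain ⟨u, hu⟩ := (hex.elementary hM hN j ![t, c, ξ]).1 ⟨_, hs⟩
    have hu' : IsSelectedAt N (j t) (j c) (j ξ) (j u) :=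
      ((UniformlyDefinable.isSelectedAt (0 : Fin 4) 1 2 3).elementary hM hN j ![t, c, ξ, u]).2 hu
    have hzu := congrArg Subtype.val (hju _ _ _ hs hu')
    simp only at hzu
    rw [hzu, map_mem_iff] at hz
    rw [hzu, ih u hz]
    exact hz
  · intro hz
    have hjz := (map_mem_iff j ⟨z, hM.mem_of_mem ⟨y, hyM⟩ hz⟩ ⟨y, hyM⟩).2 hz
    rwa [ih ⟨z, _⟩ hz] at hjz

theorem map_eq_of_mem_crit (b : M) (hb : (b : ZFSet).IsOrdinal)
    (hcrit : ∀ κ, IsCrit M N j κ → (b : ZFSet) ∈ κ) : (j b : ZFSet) = b := by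
  by_contra hne
  obtain ⟨κ, ⟨hκ, hκM, hκne⟩, hmin⟩ := ZFSet.mem_wf.has_min
    {κ : ZFSet | κ.IsOrdinal ∧ ∃ h : κ ∈ M, (j ⟨κ, h⟩ : ZFSet) ≠ κ} ⟨b, hb, b.2, hne⟩
  refine hmin b ⟨hb, b.2, hne⟩ (hcrit κ ⟨hκ, hκM, hκne, fun β hβ hβM => ?_⟩)
  by_contra h
  exact hmin β ⟨hκ.mem hβ, hβM, h⟩ hβ

theorem subset_map_of_isOrdinal (hM : IsZFCModel M) (hN : IsZFCModel N) (a : M)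
    (ha : (a : ZFSet).IsOrdinal) : (a : ZFSet) ⊆ j a := by
  obtain ⟨a, haM⟩ := a
  induction a using ZFSet.inductionOn with
  | _ a ih =>
  intro b hb
  have hbM := hM.mem_of_mem ⟨a, haM⟩ hb
  have hbo := ha.mem hb
  have hja := (map_isOrdinal_iff j hM hN ⟨a, haM⟩).2 ha
  have hjb := (map_isOrdinal_iff j hM hN ⟨b, hbM⟩).2 hbo
  exact hbo.mem_of_subset_of_mem hja (ih b hb hbM hbo) ((map_mem_iff j _ _).2 hb)

end Embeddings

section Limit

variable {M : ℕ → Set ZFSet.{u}} (j : ∀ m n, m ≤ n → (M m ↪ₑ[ZFLang] M n))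

/-- `z` belongs to `M n` and is fixed by all further maps of the system. -/
def FixedFrom (n : ℕ) (z : ZFSet.{u}) : Prop :=
  ∃ h : z ∈ M n, ∀ p (hp : n ≤ p), (j n p hp ⟨z, h⟩ : ZFSet) = z

/-- The transitive class of all sets that are hereditarily fixed by a tail of the system. -/
def hereditarilyFixed : Set ZFSet.{u} :=
  {z | ∃ n, ∃ t : ZFSet.{u}, t.IsTransitive ∧ z ∈ t ∧ ∀ w ∈ t, FixedFrom j n w}

/-- The thread of `x` is eventually constant with value `z`. -/
def IsEventualValue (m : ℕ) (x : M m) (z : ZFSet.{u}) : Prop :=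
  ∃ n, ∃ h : m ≤ n, ∀ p (hp : n ≤ p), (j m p (h.trans hp) x : ZFSet) = z

variable {j}

theorem IsEventualValue.exists_common {m : ℕ} {x y : M m} {a b : ZFSet.{u}}
    (ha : IsEventualValue j m x a) (hb : IsEventualValue j m y b) :
    ∃ n, ∃ h : m ≤ n, (j m n h x : ZFSet) = a ∧ (j m n h y : ZFSet) = b := by
  obtain ⟨p, hp, ha⟩ := ha
  obtain ⟨q, hq, hb⟩ := hb
  exact ⟨max p q, hp.trans (le_max_left _ _), ha _ (le_max_left _ _), hb _ (le_max_right _ _)⟩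

theorem IsEventualValue.mem_iff {m : ℕ} {x y : M m} {a b : ZFSet.{u}}
    (ha : IsEventualValue j m x a) (hb : IsEventualValue j m y b) :
    a ∈ b ↔ (x : ZFSet) ∈ (y : ZFSet) := by
  obtain ⟨n, h, rfl, rfl⟩ := ha.exists_common hb
  exact map_mem_iff _ _ _

theorem IsEventualValue.eq_iff {m : ℕ} {x y : M m} {a b : ZFSet.{u}}
    (ha : IsEventualValue j m x a) (hb : IsEventualValue j m y b) : a = b ↔ x = y := by
  obtain ⟨n, h, rfl, rfl⟩ := ha.exists_common hb
  rw [Subtype.val_inj, (j m n h).injective.eq_iff]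

theorem FixedFrom.isEventualValue {n : ℕ} {z : ZFSet.{u}} (h : FixedFrom j n z) :
    IsEventualValue j n ⟨z, h.1⟩ z :=
  ⟨n, le_rfl, h.2⟩

theorem setTransitive_hereditarilyFixed : SetTransitive (hereditarilyFixed j) := by
  rintro x ⟨n, t, ht, hx, hfix⟩ y hy
  exact ⟨n, t, ht, ht.mem_trans hy hx, hfix⟩

theorem hereditarilyFixed_subset : hereditarilyFixed j ⊆ ⋃ n, M n := by
  rintro x ⟨n, t, -, hx, hfix⟩
  exact Set.mem_iUnion.2 ⟨n, (hfix x hx).1⟩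

theorem exists_isEventualValue_of_mem {z : ZFSet.{u}} (hz : z ∈ hereditarilyFixed j) :
    ∃ n, ∃ y : M n, IsEventualValue j n y z := by
  obtain ⟨n, t, -, hz, hfix⟩ := hz
  exact ⟨n, _, (hfix z hz).isEventualValue⟩

theorem IsEventualValue.map
    (hcomm : ∀ m n p (h1 : m ≤ n) (h2 : n ≤ p) (x : M m),
      j m p (h1.trans h2) x = j n p h2 (j m n h1 x))
    {m n : ℕ} (h : m ≤ n) {x : M m} {z : ZFSet.{u}}
    (hz : IsEventualValue j m x z) : IsEventualValue j n (j m n h x) z := by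
  obtain ⟨p, hp, hz⟩ := hz
  refine ⟨max n p, le_max_left _ _, fun q hq => ?_⟩
  rw [← hcomm]
  exact hz q ((le_max_right _ _).trans hq)

/-- The maps into a class of eventual values are elementary, by Tarski's elementary chain
argument. -/
theorem realize_eventualValue
    (hcomm : ∀ m n p (h1 : m ≤ n) (h2 : n ≤ p) (x : M m),
      j m p (h1.trans h2) x = j n p h2 (j m n h1 x))
    {L : Set ZFSet.{u}} {k : ∀ n, M n → L}
    (hk : ∀ n x, IsEventualValue j n x (k n x))
    (hsurj : ∀ z : L, ∃ n x, k n x = z) {α : Type*} {l : ℕ}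
    (φ : ZFLang.BoundedFormula α l) (m : ℕ) (v : α → M m) (xs : Fin l → M m) :
    φ.Realize (k m ∘ v) (k m ∘ xs) ↔ φ.Realize v xs := by
  have hkj : ∀ m n (h : m ≤ n), k m = k n ∘ j m n h := fun m n h => funext fun x =>
    Subtype.ext ((((hk m x).map hcomm h).eq_iff (hk n _)).2 rfl)
  have hterm : ∀ (m : ℕ) {l : ℕ} (t : ZFLang.Term (α ⊕ Fin l)) (v : α → M m) (xs : Fin l → M m),
      t.realize (Sum.elim (k m ∘ v) (k m ∘ xs)) = k m (t.realize (Sum.elim v xs)) := by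
    intro m l t v xs
    cases t with
    | var i => cases i <;> rfl
    | func f _ => exact f.elim
  induction φ generalizing m with
  | falsum => rfl
  | equal t s =>
    simp only [BoundedFormula.Realize, hterm]
    rw [← Subtype.val_inj, (hk m _).eq_iff (hk m _)]
  | @rel l n R ts =>
    simp only [BoundedFormula.Realize, hterm]
    match n, R with
    | 2, _ => exact (hk m _).mem_iff (hk m _)
    | 0, R => exact R.elim
    | 1, R => exact R.elim
    | _ + 3, R => exact R.elim
  | imp φ ψ ih₁ ih₂ => simp only [BoundedFormula.Realize, ih₁, ih₂]
  | all φ ih =>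
    constructor
    · intro h y
      have hy := h (k m y)
      rw [← Fin.comp_snoc] at hy
      exact (ih m _ _).1 hy
    · intro h z
      obtain ⟨n, y, rfl⟩ := hsurj z
      have hp := ((j m _ (le_max_left m n)).map_boundedFormula φ.all v xs).2 h
        (j n _ (le_max_right m n) y)
      rw [hkj m _ (le_max_left m n), hkj n _ (le_max_right m n), Function.comp_assoc,
        Function.comp_assoc, Function.comp_apply, ← Fin.comp_snoc]
      exact (ih _ _ _).2 hp

end Limit

section Main

variable {d : ℕ → ZFSet.{u}} {M : ℕ → Set ZFSet.{u}} {j : ∀ m n, m ≤ n → (M m ↪ₑ[ZFLang] M n)}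

theorem mem_stage_of_le (hd : ∀ n, (d n).IsOrdinal ∧ d n ∈ d (n + 1)) {m n : ℕ} (h : m ≤ n)
    {x : ZFSet.{u}} (hx : x ∈ d m) : x ∈ d n := by
  induction n, h using Nat.le_induction with
  | base => exact hx
  | succ n _ ih => exact (hd (n + 1)).1.mem_trans ih (hd n).2

/-- The image of an ordinal below `d n` in `M n` and all its members stay fixed from `n` on. -/
theorem map_eq_of_mem_insert
    (hd : ∀ n, (d n).IsOrdinal ∧ d n ∈ d (n + 1)) (hM : ∀ n, IsZFCModel (M n))
    (hht : ∀ n, ∀ x : ZFSet.{u}, x.IsOrdinal → (x ∈ M n ↔ ∃ m, x ∈ d m))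
    (hid : ∀ n (x : M n), j n n le_rfl x = x)
    (hcomm : ∀ m n p (h1 : m ≤ n) (h2 : n ≤ p) (x : M m),
      j m p (h1.trans h2) x = j n p h2 (j m n h1 x))
    (hcrit : ∀ m n (h : m ≤ n) (κ : ZFSet.{u}),
      IsCrit (M n) (M (n + 1)) (j n (n + 1) (Nat.le_succ n)) κ →
      ∀ hdn : d n ∈ M m, (j m n h ⟨d n, hdn⟩ : ZFSet) ∈ κ)
    {m n : ℕ} (h : m ≤ n) {l : M m} (hl : (l : ZFSet).IsOrdinal)
    (hld : (l : ZFSet) ∈ d n) (p : ℕ) (hp : n ≤ p) :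
    ∀ ξ : M n, ξ = j m n h l ∨ (ξ : ZFSet) ∈ (j m n h l : ZFSet) →
      (j n p hp ξ : ZFSet) = ξ := by
  have hlo : (j m n h l : ZFSet).IsOrdinal := (map_isOrdinal_iff _ (hM m) (hM n) l).2 hl
  induction p, hp using Nat.le_induction with
  | base => intro ξ _; rw [hid]
  | succ p hp ih =>
    intro ξ hξ
    have hξo : (ξ : ZFSet).IsOrdinal := by
      rcases hξ with rfl | hξ
      exacts [hlo, hlo.mem hξ]
    have hdp : d p ∈ M m := (hht m _ (hd p).1).2 ⟨p + 1, (hd p).2⟩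
    rw [hcomm n p (p + 1) hp (Nat.le_succ p)]
    rw [map_eq_of_mem_crit _ _ ((map_isOrdinal_iff _ (hM n) (hM p) ξ).2 hξo), ih ξ hξ]
    intro κ hκ
    have hlκ : (j m p (h.trans hp) l : ZFSet) ∈ κ :=
      hκ.1.mem_trans ((map_mem_iff _ l ⟨d p, hdp⟩).2 (mem_stage_of_le hd hp hld))
        (hcrit m p (h.trans hp) κ hκ hdp)
    rcases hξ with rfl | hξ
    · rwa [← hcomm m n p h hp]
    · refine hκ.1.mem_trans ?_ hlκ
      rw [hcomm m n p h hp]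
      exact (map_mem_iff _ _ _).2 hξ

theorem exists_isEventualValue
    (hd : ∀ n, (d n).IsOrdinal ∧ d n ∈ d (n + 1)) (hM : ∀ n, IsZFCModel (M n))
    (hht : ∀ n, ∀ x : ZFSet.{u}, x.IsOrdinal → (x ∈ M n ↔ ∃ m, x ∈ d m))
    (hid : ∀ n (x : M n), j n n le_rfl x = x)
    (hcomm : ∀ m n p (h1 : m ≤ n) (h2 : n ≤ p) (x : M m),
      j m p (h1.trans h2) x = j n p h2 (j m n h1 x))
    (hcrit : ∀ m n (h : m ≤ n) (κ : ZFSet.{u}),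
      IsCrit (M n) (M (n + 1)) (j n (n + 1) (Nat.le_succ n)) κ →
      ∀ hdn : d n ∈ M m, (j m n h ⟨d n, hdn⟩ : ZFSet) ∈ κ)
    (m : ℕ) (x : M m) :
    ∃ z ∈ hereditarilyFixed j, IsEventualValue j m x z := by
  obtain ⟨t, c, l, hl, hxt, he⟩ := exists_isEnumerated (hM m) x
  obtain ⟨n₀, hn₀⟩ := (hht m l hl).1 l.2
  obtain ⟨n, h, hld⟩ : ∃ n, m ≤ n ∧ (l : ZFSet) ∈ d n :=
    ⟨max m n₀, le_max_left _ _, mem_stage_of_le hd (le_max_right _ _) hn₀⟩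
  have hen := he.map (j m n h) (hM m) (hM n)
  have hfix : ∀ y : M n, (y : ZFSet) ∈ (j m n h t : ZFSet) →
      ∀ p (hp : n ≤ p), (j n p hp y : ZFSet) = y := fun y hy p hp =>
    have hmap := map_eq_of_mem_insert hd hM hht hid hcomm hcrit h hl hld p hp
    hen.map_eq _ (hM n) (hM p) (hmap _ (.inl rfl)) (fun ξ hξ => hmap ξ (.inr hξ)) y hy
  have hjx : (j m n h x : ZFSet) ∈ (j m n h t : ZFSet) := (map_mem_iff _ _ _).2 hxt
  refine ⟨j m n h x, ⟨n, j m n h t, hen.1, hjx, fun w hw => ?_⟩, n, h, fun p hp => ?_⟩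
  · exact ⟨(hM n).mem_of_mem _ hw, hfix ⟨w, _⟩ hw⟩
  · rw [hcomm m n p h hp]
    exact hfix _ hjx p hp

theorem mem_hereditarilyFixed_iff
    (hd : ∀ n, (d n).IsOrdinal ∧ d n ∈ d (n + 1)) (hM : ∀ n, IsZFCModel (M n))
    (hht : ∀ n, ∀ x : ZFSet.{u}, x.IsOrdinal → (x ∈ M n ↔ ∃ m, x ∈ d m))
    (hid : ∀ n (x : M n), j n n le_rfl x = x)
    (hcomm : ∀ m n p (h1 : m ≤ n) (h2 : n ≤ p) (x : M m),
      j m p (h1.trans h2) x = j n p h2 (j m n h1 x))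
    (hcrit : ∀ m n (h : m ≤ n) (κ : ZFSet.{u}),
      IsCrit (M n) (M (n + 1)) (j n (n + 1) (Nat.le_succ n)) κ →
      ∀ hdn : d n ∈ M m, (j m n h ⟨d n, hdn⟩ : ZFSet) ∈ κ)
    {x : ZFSet.{u}} (hx : x.IsOrdinal) :
    x ∈ hereditarilyFixed j ↔ ∃ m, x ∈ d m := by
  constructor
  · intro h
    obtain ⟨n, hn⟩ := Set.mem_iUnion.1 (hereditarilyFixed_subset h)
    exact (hht n x hx).1 hn
  · intro h
    have hx0 := (hht 0 x hx).2 h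
    obtain ⟨z, hz, n, hn, hxz⟩ := exists_isEventualValue hd hM hht hid hcomm hcrit 0 ⟨x, hx0⟩
    obtain rfl := hxz n le_rfl
    have hjx := (map_isOrdinal_iff (j 0 n hn) (hM 0) (hM n) ⟨x, hx0⟩).2 hx
    rcases (hx.subset_iff_eq_or_mem hjx).1
      (subset_map_of_isOrdinal (j 0 n hn) (hM 0) (hM n) ⟨x, hx0⟩ hx) with h | h
    · rw [h]; exact hz
    · exact setTransitive_hereditarilyFixed _ hz _ h

end Main

/-- Lemma 4.4: a commuting ω-chain of elementary embeddings between
transitive ZFC models of height `δ = sup δ_n`, with `crit(j_{n,n+1}) > j_{m,n}(δ_n)`, has a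
well-founded direct limit isomorphic to a transitive model `M_ω` of height `δ` with
`M_ω ⊆ ⋃_n M_n`. -/
theorem stmt5
    (d : ℕ → ZFSet) (hd : ∀ n, (d n).IsOrdinal ∧ d n ∈ d (n + 1))
    (M : ℕ → Set ZFSet) (hM : ∀ n, IsZFCModel (M n))
    (hht : ∀ n, ∀ x : ZFSet, x.IsOrdinal → (x ∈ M n ↔ ∃ m, x ∈ d m))
    (j : ∀ m n, m ≤ n → (↥(M m) ↪ₑ[ZFLang] ↥(M n)))
    (hid : ∀ n (x : ↥(M n)), j n n le_rfl x = x)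
    (hcomm : ∀ m n p (h1 : m ≤ n) (h2 : n ≤ p) (x : ↥(M m)),
      j m p (h1.trans h2) x = j n p h2 (j m n h1 x))
    (hcrit : ∀ m n (h : m ≤ n) (κ : ZFSet),
      IsCrit (M n) (M (n + 1)) (⇑(j n (n + 1) (Nat.le_succ n))) κ →
      ∀ hdn : d n ∈ M m, ((j m n h ⟨d n, hdn⟩ : ↥(M n)) : ZFSet) ∈ κ) :
    ∃ Mω : Set ZFSet, SetTransitive Mω ∧
      (∀ x : ZFSet, x.IsOrdinal → (x ∈ Mω ↔ ∃ m, x ∈ d m)) ∧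
      Mω ⊆ ⋃ n, M n ∧
      ∃ k : ∀ n, ↥(M n) ↪ₑ[ZFLang] ↥Mω,
        (∀ m n (h : m ≤ n) (x : ↥(M m)), k m x = k n (j m n h x)) ∧
        (∀ x ∈ Mω, ∃ n, ∃ y : ↥(M n), ((k n y : ↥Mω) : ZFSet) = x) := by
  refine ⟨hereditarilyFixed j, setTransitive_hereditarilyFixed,
    fun x => mem_hereditarilyFixed_iff hd hM hht hid hcomm hcrit, hereditarilyFixed_subset, ?_⟩
  choose k hkmem hk using exists_isEventualValue hd hM hht hid hcomm hcrit
  have hsurj : ∀ z ∈ hereditarilyFixed j, ∃ n, ∃ y : M n, k n y = z := fun z hz =>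
    have ⟨n, y, hy⟩ := exists_isEventualValue_of_mem hz
    ⟨n, y, ((hk n y).eq_iff hy).2 rfl⟩
  refine ⟨fun n => ⟨fun x => ⟨k n x, hkmem n x⟩, fun _ φ v => ?_⟩, fun m n h x => ?_, hsurj⟩
  · have := realize_eventualValue hcomm (k := fun n x => ⟨k n x, hkmem n x⟩) hk
      (fun z => (hsurj z z.2).imp fun n h => h.imp fun y hy => Subtype.ext hy) φ n v default
    rwa [Unique.eq_default (_ ∘ default)] at this
  · exact Subtype.ext ((((hk m x).map hcomm h).eq_iff (hk n _)).2 rfl)
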